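/- arXiv:1701.07691 — 2 statements merged into one kernel-verified Lean document; each statement's English description precedes it below -/
import Mathlib

section
/- Let d ≥ 1, s > 0, E ⊆ ℝ^d be a non-degenerate parallelepiped and let f be a smooth E-periodic function on ℝ^d. Then the following are equivalent: (i) there exist constants C, h > 0 such that ‖∂^β f‖_{L^∞(ℝ^d)} ≤ C h^{|β|} (β!)^s for every multi-index β; (ii) there exist constants C, r > 0 such that |c(f,α)| ≤ C e^{-r|α|^{1/s}} for every α ∈ Λ'_E. -/
open MeasureTheory Filter
open scoped BigOperators InnerProductSpace Topology

noncomputable section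

abbrev Euc (d : ℕ) := EuclideanSpace ℝ (Fin d)

/-- The lattice point `∑ i, j i • e i` associated with `j : ℤ^d`. -/
def latPt {d : ℕ} (e : Fin d → Euc d) (j : Fin d → ℤ) : Euc d :=
  ∑ i, (j i : ℝ) • e i

/-- The (closed) parallelepiped spanned by `e`. -/
def paraSet {d : ℕ} (e : Fin d → Euc d) : Set (Euc d) :=
  (fun t : Fin d → ℝ => ∑ i, t i • e i) '' (Set.univ.pi fun _ => Set.Icc (0:ℝ) 1)

/-- Fourier coefficient `c(f, ξ) = |E|⁻¹ ∫_E f(x) e^{-i⟨x,ξ⟩} dx`. -/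
def fourCoeff {d : ℕ} (e : Fin d → Euc d) (f : Euc d → ℂ) (ξ : Euc d) : ℂ :=
  (((volume (paraSet e)).toReal : ℂ))⁻¹ *
    ∫ x in paraSet e, f x * Complex.exp (-(Complex.I) * (⟪x, ξ⟫_ℝ : ℂ))

/-- Iterated partial derivatives along a list of coordinate directions. -/
def pdSeq {d : ℕ} : List (Fin d) → (Euc d → ℂ) → (Euc d → ℂ)
  | [], f => f
  | (i :: L), f => pdSeq L (fun x => fderiv ℝ f x (EuclideanSpace.single i 1))

/-- The canonical list of directions attached to a multi-index `β`. -/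
def mIdxL {d : ℕ} (β : Fin d → ℕ) : List (Fin d) :=
  (List.finRange d).flatMap fun i => List.replicate (β i) i

/-- The multi-index partial derivative `∂^β f`. -/
def pD {d : ℕ} (β : Fin d → ℕ) (f : Euc d → ℂ) : Euc d → ℂ := pdSeq (mIdxL β) f

/-- Fourier transform, normalized as `(2π)^{-d/2} ∫ f(x) e^{-i⟨x,ξ⟩} dx`. -/
def FT {d : ℕ} (f : Euc d → ℂ) (ξ : Euc d) : ℂ :=
  (((2 * Real.pi) ^ (-(d:ℝ)/2) : ℝ) : ℂ) *
    ∫ x, f x * Complex.exp (-(Complex.I) * (⟪x, ξ⟫_ℝ : ℂ))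

/-- Short-time Fourier transform with window `φ`. -/
def STFT {d : ℕ} (φ f : Euc d → ℂ) (x ξ : Euc d) : ℂ :=
  (((2 * Real.pi) ^ (-(d:ℝ)/2) : ℝ) : ℂ) *
    ∫ y, f y * (starRingEnd ℂ) (φ (y - x)) * Complex.exp (-(Complex.I) * (⟪y, ξ⟫_ℝ : ℂ))

theorem pow_le_rpow_factorial_mul_exp {s q t : ℝ} (hs : 0 < s) (hq : 0 < q) (ht : 0 ≤ t)
    (n : ℕ) :
    t ^ n ≤ (q ^ (-s)) ^ n * (n.factorial : ℝ) ^ s * Real.exp (q * s * t ^ (1 / s)) := by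
  set u := t ^ (1 / s) with hu
  have hu0 : 0 ≤ u := Real.rpow_nonneg ht _
  have htu : t = u ^ s := by
    rw [hu, ← Real.rpow_mul ht, one_div_mul_cancel hs.ne', Real.rpow_one]
  have hfac : (0 : ℝ) < n.factorial := by exact_mod_cast n.factorial_pos
  have h1 : (q * u) ^ n ≤ n.factorial * Real.exp (q * u) := by
    have := Real.pow_div_factorial_le_exp (q * u) (by positivity) n
    rwa [div_le_iff₀' hfac] at this
  have h2 := Real.rpow_le_rpow (by positivity) h1 hs.le
  rw [Real.mul_rpow hfac.le (Real.exp_pos _).le, ← Real.exp_mul,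
    ← Real.rpow_pow_comm (by positivity), Real.mul_rpow hq.le hu0, ← htu,
    mul_pow] at h2
  rw [Real.rpow_neg hq.le, inv_pow, mul_assoc, ← div_eq_inv_mul, le_div_iff₀ (by positivity)]
  calc t ^ n * (q ^ s) ^ n = (q ^ s) ^ n * t ^ n := mul_comm _ _
    _ ≤ _ := h2
    _ = _ := by ring_nf

theorem le_exp_of_forall_mul_pow_le {s a t C : ℝ} (hs : 0 < s) (ha : 0 ≤ a) (hC : 0 ≤ C)
    (ht : 0 ≤ t) (h : ∀ n : ℕ, a * t ^ n ≤ C * (n.factorial : ℝ) ^ s) :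
    a ≤ 2 ^ s * C * Real.exp (-(s / 2) * t ^ (1 / s)) := by
  set u := t ^ (1 / s) with hu
  have hu0 : 0 ≤ u := Real.rpow_nonneg ht _
  have key : a ^ (1 / s) * Real.exp (u / 2) ≤ C ^ (1 / s) * 2 := by
    have hexp : HasSum (fun n : ℕ => (u / 2) ^ n / (n.factorial : ℝ)) (Real.exp (u / 2)) := by
      rw [Real.exp_eq_exp_ℝ]
      exact NormedSpace.expSeries_div_hasSum_exp (u / 2)
    refine hasSum_le (fun n => ?_) (hexp.mul_left (a ^ (1 / s)))
      (hasSum_geometric_two.mul_left (C ^ (1 / s)))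
    have hfac : (0 : ℝ) < n.factorial := by exact_mod_cast n.factorial_pos
    have h2 := Real.rpow_le_rpow (by positivity) (h n) (one_div_pos.2 hs).le
    rw [Real.mul_rpow ha (by positivity), Real.mul_rpow hC (by positivity),
      ← Real.rpow_mul hfac.le, mul_one_div_cancel hs.ne', Real.rpow_one,
      ← Real.rpow_pow_comm ht, ← hu] at h2
    rw [div_pow, div_div, mul_div_assoc', div_le_iff₀ (by positivity)]
    calc _ ≤ _ := h2
      _ = _ := by rw [div_pow, one_pow]; field_simp
  have h3 := Real.rpow_le_rpow (by positivity) key hs.le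
  rw [Real.mul_rpow (by positivity) (Real.exp_pos _).le, Real.mul_rpow (by positivity) (by norm_num),
    ← Real.rpow_mul ha, ← Real.rpow_mul hC, one_div_mul_cancel hs.ne', Real.rpow_one,
    Real.rpow_one, ← Real.exp_mul] at h3
  rw [neg_mul, Real.exp_neg, ← div_eq_mul_inv, le_div_iff₀ (Real.exp_pos _)]
  calc _ = a * Real.exp (u / 2 * s) := by ring_nf
    _ ≤ _ := h3
    _ = _ := mul_comm _ _

theorem paraSet_eq_parallelepiped {d : ℕ} (e : Fin d → Euc d) : paraSet e = parallelepiped e := by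
  rw [paraSet, parallelepiped, Set.pi_univ_Icc]
  rfl

theorem isCompact_paraSet {d : ℕ} (e : Fin d → Euc d) : IsCompact (paraSet e) :=
  (isCompact_univ_pi fun _ => isCompact_Icc).image (by fun_prop)

theorem exists_latPt_eq {d : ℕ} (e : Fin d → Euc d) {x : Euc d}
    (hx : x ∈ Submodule.span ℤ (Set.range e)) : ∃ j : Fin d → ℤ, latPt e j = x := by
  obtain ⟨j, rfl⟩ := (Submodule.mem_span_range_iff_exists_fun ℤ).1 hx
  exact ⟨j, by simp only [latPt, Int.cast_smul_eq_zsmul]⟩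

theorem latPt_mem_span {d : ℕ} (e : Fin d → Euc d) (j : Fin d → ℤ) :
    latPt e j ∈ Submodule.span ℤ (Set.range e) :=
  (Submodule.mem_span_range_iff_exists_fun ℤ).2
    ⟨j, by simp only [latPt, Int.cast_smul_eq_zsmul]⟩

open scoped Pointwise in
theorem setIntegral_paraSet_add_right {d : ℕ} (b : Module.Basis (Fin d) ℝ (Euc d)) {F : Euc d → ℂ}
    (hper : ∀ x j, F (x + latPt b j) = F x) (v : Euc d) :
    ∫ x in paraSet b, F (x + v) = ∫ x in paraSet b, F x := by
  have hD := ZSpan.isAddFundamentalDomain' b (volume : Measure (Euc d))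
  have hae := ZSpan.fundamentalDomain_ae_parallelepiped b (volume : Measure (Euc d))
  rw [paraSet_eq_parallelepiped, ← setIntegral_congr_set hae, ← setIntegral_congr_set hae]
  have hpre : ∫ x in ZSpan.fundamentalDomain b, F (x + v) =
      ∫ x in (v +ᵥ ZSpan.fundamentalDomain b), F x := by
    rw [← (measurePreserving_add_right volume v).setIntegral_preimage_emb
      (measurableEmbedding_addRight v) F (v +ᵥ ZSpan.fundamentalDomain b)]
    congr 2
    ext x
    simp [Set.mem_vadd_set_iff_neg_vadd_mem, add_comm]
  rw [hpre]
  have : Countable (Submodule.span ℤ (Set.range b)).toAddSubgroup :=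
    inferInstanceAs (Countable (Submodule.span ℤ (Set.range b)))
  refine (hD.vadd_of_comm v).setIntegral_eq hD fun g x => ?_
  obtain ⟨j, hj⟩ := exists_latPt_eq b g.2
  rw [AddSubgroup.vadd_def, ← hj, vadd_eq_add, add_comm, hper]

theorem setIntegral_paraSet_fderiv_eq_zero {d : ℕ} (b : Module.Basis (Fin d) ℝ (Euc d))
    {F : Euc d → ℂ} (hF : ContDiff ℝ 1 F) (hper : ∀ x j, F (x + latPt b j) = F x) (v : Euc d) :
    ∫ x in paraSet b, fderiv ℝ F x v = 0 := by
  have hK : IsCompact (Metric.closedBall (0 : ℝ) 1 ×ˢ paraSet b) :=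
    (isCompact_closedBall 0 1).prod (isCompact_paraSet b)
  have hF' : Continuous (fderiv ℝ F) := hF.continuous_fderiv one_ne_zero
  have hcont : Continuous fun p : ℝ × Euc d => fderiv ℝ F (p.2 + p.1 • v) v := by fun_prop
  obtain ⟨M, hM⟩ := hK.exists_bound_of_continuousOn hcont.continuousOn
  have hFc := hF.continuous
  have hmeas : MeasurableSet (paraSet b) := (isCompact_paraSet b).measurableSet
  have hder := (hasDerivAt_integral_of_dominated_loc_of_deriv_le
    (μ := volume.restrict (paraSet b)) (F := fun (t : ℝ) x => F (x + t • v))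
    (F' := fun (t : ℝ) x => fderiv ℝ F (x + t • v) v) (bound := fun _ => M) (x₀ := 0)
    (Metric.closedBall_mem_nhds (0 : ℝ) one_pos)
    (Eventually.of_forall fun t => (by fun_prop : Continuous _).aestronglyMeasurable)
    ((by fun_prop : Continuous fun x : Euc d => F (x + (0 : ℝ) • v)).continuousOn.integrableOn_compact
      (isCompact_paraSet b))
    (by fun_prop : Continuous _).aestronglyMeasurable
    ((ae_restrict_iff' hmeas).2 (Eventually.of_forall fun x hx t ht => hM (t, x) ⟨ht, hx⟩))
    (continuousOn_const.integrableOn_compact (isCompact_paraSet b))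
    (Eventually.of_forall fun x t _ => by
      have h1 : HasDerivAt (fun t : ℝ => x + t • v) v t := by
        simpa using ((hasDerivAt_id t).smul_const v).const_add x
      exact (hF.differentiable one_ne_zero _).hasFDerivAt.comp_hasDerivAt t h1)).2
  simp only [setIntegral_paraSet_add_right b hper, zero_smul, add_zero] at hder
  exact hder.unique (hasDerivAt_const _ _)

theorem volume_paraSet_toReal_pos {d : ℕ} (b : Module.Basis (Fin d) ℝ (Euc d)) :
    0 < (volume (paraSet b)).toReal := by
  refine ENNReal.toReal_pos ?_ (isCompact_paraSet b).measure_lt_top.ne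
  rw [paraSet_eq_parallelepiped,
    ← measure_congr (ZSpan.fundamentalDomain_ae_parallelepiped b (volume : Measure (Euc d)))]
  exact ZSpan.measure_fundamentalDomain_ne_zero b

theorem inv_volume_mul_setIntegral_paraSet {d : ℕ} (b : Module.Basis (Fin d) ℝ (Euc d))
    (g : Euc d → ℂ) :
    (((volume (paraSet b)).toReal : ℂ))⁻¹ * ∫ x in paraSet b, g x =
      ∫ t in (Set.univ.pi fun _ : Fin d => Set.Icc (0 : ℝ) 1), g (∑ i, t i • b i) := by
  have hpos := volume_paraSet_toReal_pos b
  let A : (Fin d → ℝ) ≃L[ℝ] Euc d := b.equivFun.symm.toContinuousLinearEquiv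
  have hA : ∀ t, A t = ∑ i, t i • b i := fun t => b.equivFun_symm_apply t
  let ν : Measure (Fin d → ℝ) := (volume : Measure (Euc d)).map A.symm
  have : ν.IsAddHaarMeasure := A.symm.isAddHaarMeasure_map volume
  have hν := Measure.isAddLeftInvariant_eq_smul ν (volume : Measure (Fin d → ℝ))
  set c := ν.addHaarScalarFactor (volume : Measure (Fin d → ℝ))
  set Q := (Set.univ.pi fun _ : Fin d => Set.Icc (0 : ℝ) 1) with hQ
  have hpre : A.symm ⁻¹' Q = paraSet b := by
    rw [← ContinuousLinearEquiv.image_eq_preimage_symm, paraSet]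
    exact Set.image_congr fun t _ => hA t
  have hemb : MeasurableEmbedding A.symm := A.symm.toHomeomorph.measurableEmbedding
  have hQvol : (volume : Measure (Fin d → ℝ)) Q = 1 := by
    rw [hQ, volume_pi_pi]; simp
  have hvol : volume (paraSet b) = c := by
    rw [← hpre, ← hemb.map_apply]
    change ν Q = _
    rw [hν, Measure.smul_apply, hQvol]; simp
  have hint : ∫ x in paraSet b, g x = (c : ℝ) • ∫ t in Q, g (A t) := by
    have h1 := hemb.setIntegral_map (μ := volume) (fun t => g (A t)) Q
    rw [hpre] at h1
    simp only [ContinuousLinearEquiv.apply_symm_apply] at h1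
    rw [← h1]
    change ∫ t in Q, g (A t) ∂ν = _
    rw [hν, Measure.restrict_smul, integral_smul_nnreal_measure]
    rfl
  rw [hvol] at hpos ⊢
  simp only [ENNReal.coe_toReal] at hpos ⊢
  rw [hint]
  simp only [hA, Complex.real_smul]
  rw [inv_mul_cancel_left₀]
  exact_mod_cast hpos.ne'

theorem hasFDerivAt_cexp_mul_inner {d : ℕ} (c : ℂ) (α x : Euc d) :
    HasFDerivAt (fun x : Euc d => Complex.exp (c * (⟪x, α⟫_ℝ : ℂ)))
      ((Complex.exp (c * (⟪x, α⟫_ℝ : ℂ)) * c) • (Complex.ofRealCLM ∘L innerSL ℝ α)) x := by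
  have h : HasFDerivAt (fun x : Euc d => (⟪x, α⟫_ℝ : ℂ)) (Complex.ofRealCLM ∘L innerSL ℝ α) x := by
    have h0 : (fun y : Euc d => (⟪y, α⟫_ℝ : ℂ)) = ⇑(Complex.ofRealCLM ∘L innerSL ℝ α) :=
      funext fun y => congrArg Complex.ofReal (real_inner_comm α y)
    rw [h0]
    exact ContinuousLinearMap.hasFDerivAt _
  have h2 := (h.const_mul c).cexp
  rwa [smul_smul] at h2

theorem cexp_neg_I_mul_inner_add_latPt {d : ℕ} {e e' : Fin d → Euc d}
    (hdual : ∀ j k, ⟪e j, e' k⟫_ℝ = if j = k then 2 * Real.pi else 0) (x : Euc d)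
    (j ι : Fin d → ℤ) :
    Complex.exp (-(Complex.I) * (⟪x + latPt e j, latPt e' ι⟫_ℝ : ℂ)) =
      Complex.exp (-(Complex.I) * (⟪x, latPt e' ι⟫_ℝ : ℂ)) := by
  have h : ⟪latPt e j, latPt e' ι⟫_ℝ = ((∑ i, j i * ι i : ℤ) : ℝ) * (2 * Real.pi) := by
    simp only [latPt, sum_inner, inner_sum, inner_smul_left, inner_smul_right, hdual]
    simp only [mul_ite, mul_zero, Finset.sum_ite_eq', Finset.mem_univ, if_true]
    push_cast
    rw [Finset.sum_mul]
    exact Finset.sum_congr rfl fun i _ => by simp; ring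
  rw [inner_add_left, h, Complex.exp_eq_exp_iff_exists_int]
  refine ⟨-∑ i, j i * ι i, ?_⟩
  push_cast
  ring

theorem contDiff_fderiv_apply_const {d : ℕ} {f : Euc d → ℂ} (hf : ContDiff ℝ (⊤ : ℕ∞) f)
    (v : Euc d) : ContDiff ℝ (⊤ : ℕ∞) fun x => fderiv ℝ f x v :=
  (hf.fderiv_right (m := (⊤ : ℕ∞)) (by simp)).clm_apply contDiff_const

theorem fderiv_add_eq_of_periodic {d : ℕ} {f : Euc d → ℂ} {p : Euc d}
    (hper : ∀ x, f (x + p) = f x) (x : Euc d) : fderiv ℝ f (x + p) = fderiv ℝ f x := by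
  rw [← fderiv_comp_add_right]
  simp only [hper]

theorem fourCoeff_fderiv {d : ℕ} (b : Module.Basis (Fin d) ℝ (Euc d)) {e' : Fin d → Euc d}
    (hdual : ∀ j k, ⟪b j, e' k⟫_ℝ = if j = k then 2 * Real.pi else 0)
    {f : Euc d → ℂ} (hf : ContDiff ℝ (⊤ : ℕ∞) f) (hper : ∀ x j, f (x + latPt b j) = f x)
    (ι : Fin d → ℤ) (v : Euc d) :
    fourCoeff b (fun x => fderiv ℝ f x v) (latPt e' ι) =
      (Complex.I * (⟪v, latPt e' ι⟫_ℝ : ℂ)) * fourCoeff b f (latPt e' ι) := by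
  set α := latPt e' ι with hα
  let w : Euc d → ℂ := fun x => Complex.exp (-(Complex.I) * (⟪x, α⟫_ℝ : ℂ))
  have hw : ContDiff ℝ 1 w :=
    (contDiff_const.mul (Complex.ofRealCLM.contDiff.comp
      (contDiff_id.inner ℝ contDiff_const))).cexp
  have hf1 : ContDiff ℝ 1 f := hf.of_le (by exact_mod_cast le_top)
  have hzero := setIntegral_paraSet_fderiv_eq_zero b (hf1.mul hw) (fun x j => by
    simp only [w, hper, hα, cexp_neg_I_mul_inner_add_latPt hdual]) v
  have hfd : ∀ x, fderiv ℝ (fun x => f x * w x) x v =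
      fderiv ℝ f x v * w x - (Complex.I * (⟪v, α⟫_ℝ : ℂ)) * (f x * w x) := by
    intro x
    have h : HasFDerivAt (fun x => f x * w x) _ x :=
      (hf1.differentiable one_ne_zero x).hasFDerivAt.mul
        (hasFDerivAt_cexp_mul_inner (-Complex.I) α x)
    rw [h.fderiv]
    simp [w, real_inner_comm]
    ring
  have hfc := hf1.continuous
  have hf'c := hf1.continuous_fderiv one_ne_zero
  have hwc := hw.continuous
  have hint1 : IntegrableOn (fun x => fderiv ℝ f x v * w x) (paraSet b) :=
    (by fun_prop : Continuous _).continuousOn.integrableOn_compact (isCompact_paraSet b)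
  have hint2 : IntegrableOn (fun x => (Complex.I * (⟪v, α⟫_ℝ : ℂ)) * (f x * w x)) (paraSet b) :=
    (by fun_prop : Continuous _).continuousOn.integrableOn_compact (isCompact_paraSet b)
  simp only [hfd] at hzero
  rw [integral_sub hint1 hint2, sub_eq_zero, integral_const_mul] at hzero
  simp only [fourCoeff]
  rw [hzero]
  ring

theorem fourCoeff_pdSeq {d : ℕ} (b : Module.Basis (Fin d) ℝ (Euc d)) {e' : Fin d → Euc d}
    (hdual : ∀ j k, ⟪b j, e' k⟫_ℝ = if j = k then 2 * Real.pi else 0)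
    (L : List (Fin d)) {f : Euc d → ℂ} (hf : ContDiff ℝ (⊤ : ℕ∞) f)
    (hper : ∀ x j, f (x + latPt b j) = f x) (ι : Fin d → ℤ) :
    fourCoeff b (pdSeq L f) (latPt e' ι) =
      (L.map fun i => Complex.I * (latPt e' ι i : ℂ)).prod * fourCoeff b f (latPt e' ι) := by
  induction L generalizing f with
  | nil => simp [pdSeq]
  | cons i L ih =>
    rw [pdSeq, ih (contDiff_fderiv_apply_const hf _)
      (fun x j => by rw [fderiv_add_eq_of_periodic fun x => hper x j]),
      fourCoeff_fderiv b hdual hf hper]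
    simp only [EuclideanSpace.inner_single_left, List.map_cons, List.prod_cons]
    simp
    ring

theorem norm_fourCoeff_le {d : ℕ} (b : Module.Basis (Fin d) ℝ (Euc d)) {g : Euc d → ℂ} {M : ℝ}
    (hg : ∀ x, ‖g x‖ ≤ M) (ξ : Euc d) : ‖fourCoeff b g ξ‖ ≤ M := by
  have hpos := volume_paraSet_toReal_pos b
  have h : ‖∫ x in paraSet b, g x * Complex.exp (-(Complex.I) * (⟪x, ξ⟫_ℝ : ℂ))‖ ≤
      M * volume.real (paraSet b) := by
    refine norm_setIntegral_le_of_norm_le_const (isCompact_paraSet b).measure_lt_top fun x _ => ?_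
    rw [norm_mul, Complex.norm_exp]
    simpa using hg x
  rw [fourCoeff, norm_mul, norm_inv, Complex.norm_real, Real.norm_of_nonneg hpos.le,
    inv_mul_le_iff₀ hpos, mul_comm]
  exact h

theorem mIdxL_single {d : ℕ} (k : Fin d) (n : ℕ) :
    mIdxL (Pi.single k n) = List.replicate n k := by
  have h : ∀ l : List (Fin d), l.Nodup → l.flatMap (fun i => List.replicate
      ((Pi.single k n : Fin d → ℕ) i) i) = if k ∈ l then List.replicate n k else [] := by
    intro l hl
    induction l with
    | nil => simp
    | cons a l ih =>
      rw [List.nodup_cons] at hl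
      rw [List.flatMap_cons, ih hl.2]
      by_cases hak : k = a
      · subst hak
        simp [hl.1]
      · simp [hak]
  rw [mIdxL, h _ (List.nodup_finRange d), if_pos (List.mem_finRange k)]

theorem exists_norm_le_mul_abs_apply {d : ℕ} (hd : 1 ≤ d) (x : Euc d) :
    ∃ k, ‖x‖ ≤ d * |x k| := by
  have : Nonempty (Fin d) := ⟨⟨0, hd⟩⟩
  obtain ⟨k, hk⟩ := Finite.exists_max fun i => |x i|
  refine ⟨k, ?_⟩
  have hx : x = ∑ i, EuclideanSpace.single i (x i) := by
    ext j
    simp [Finset.sum_apply, Pi.single_apply]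
  calc ‖x‖ = ‖∑ i, EuclideanSpace.single i (x i)‖ := by rw [← hx]
    _ ≤ ∑ i, ‖EuclideanSpace.single i (x i)‖ := norm_sum_le _ _
    _ ≤ ∑ _i : Fin d, |x k| := Finset.sum_le_sum fun i _ => by simpa using hk i
    _ = _ := by simp

theorem norm_fourCoeff_mul_pow_le {d : ℕ} (hd : 1 ≤ d) {s : ℝ}
    (b : Module.Basis (Fin d) ℝ (Euc d)) {e' : Fin d → Euc d}
    (hdual : ∀ j k, ⟪b j, e' k⟫_ℝ = if j = k then 2 * Real.pi else 0)
    {f : Euc d → ℂ} (hf : ContDiff ℝ (⊤ : ℕ∞) f) (hper : ∀ x j, f (x + latPt b j) = f x)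
    {C h : ℝ} (hh : 0 < h)
    (hbound : ∀ (β : Fin d → ℕ) (x : Euc d),
      ‖pD β f x‖ ≤ C * h ^ (∑ i, β i) * (((∏ i, (β i).factorial : ℕ) : ℝ)) ^ s)
    (ι : Fin d → ℤ) (n : ℕ) :
    ‖fourCoeff b f (latPt e' ι)‖ * (‖latPt e' ι‖ / (d * h)) ^ n ≤ C * (n.factorial : ℝ) ^ s := by
  set α := latPt e' ι with hα
  obtain ⟨k, hk⟩ := exists_norm_le_mul_abs_apply hd α
  have hd0 : (0 : ℝ) < d := by exact_mod_cast hd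
  have hfac : ∏ i, ((Pi.single k n : Fin d → ℕ) i).factorial = n.factorial := by
    rw [Finset.prod_eq_single k (fun i _ hi => by simp [Pi.single_eq_of_ne hi]) (by simp)]
    simp
  have h1 : ‖fourCoeff b (pD (Pi.single k n) f) α‖ ≤ C * h ^ n * (n.factorial : ℝ) ^ s := by
    refine norm_fourCoeff_le b (fun x => ?_) α
    simpa only [hfac, Finset.sum_pi_single', Finset.mem_univ, if_true] using
      hbound (Pi.single k n) x
  rw [pD, mIdxL_single, hα, fourCoeff_pdSeq b hdual _ hf hper, ← hα, norm_mul] at h1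
  simp only [List.map_replicate, List.prod_replicate, norm_pow, norm_mul, Complex.norm_I, one_mul,
    Complex.norm_real, Real.norm_eq_abs] at h1
  have h2 : ‖α‖ / (d * h) ≤ |α k| / h := by
    rw [div_le_div_iff₀ (by positivity) hh]
    nlinarith
  calc ‖fourCoeff b f α‖ * (‖α‖ / (d * h)) ^ n ≤ ‖fourCoeff b f α‖ * (|α k| / h) ^ n := by
        gcongr
    _ = (|α k| ^ n * ‖fourCoeff b f α‖) / h ^ n := by rw [div_pow]; ring
    _ ≤ (C * h ^ n * (n.factorial : ℝ) ^ s) / h ^ n := by gcongr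
    _ = _ := by field_simp

theorem inner_sum_smul_latPt {d : ℕ} {e e' : Fin d → Euc d}
    (hdual : ∀ j k, ⟪e j, e' k⟫_ℝ = if j = k then 2 * Real.pi else 0) (t : Fin d → ℝ)
    (ι : Fin d → ℤ) :
    ⟪∑ i, t i • e i, latPt e' ι⟫_ℝ = ∑ i, 2 * Real.pi * ι i * t i := by
  simp only [latPt, sum_inner, inner_sum, inner_smul_left, inner_smul_right, hdual]
  simp only [mul_ite, mul_zero, Finset.sum_ite_eq', Finset.mem_univ, if_true]
  exact Finset.sum_congr rfl fun i _ => by simp; ring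

theorem mFourier_coe_eq_cexp {d : ℕ} {e e' : Fin d → Euc d}
    (hdual : ∀ j k, ⟪e j, e' k⟫_ℝ = if j = k then 2 * Real.pi else 0) (t : Fin d → ℝ)
    (ι : Fin d → ℤ) :
    UnitAddTorus.mFourier ι (fun i => (t i : UnitAddCircle)) =
      Complex.exp (Complex.I * (⟪∑ i, t i • e i, latPt e' ι⟫_ℝ : ℂ)) := by
  rw [inner_sum_smul_latPt hdual]
  simp only [UnitAddTorus.mFourier, ContinuousMap.coe_mk, fourier_coe_apply]
  rw [← Complex.exp_sum]
  push_cast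
  rw [Finset.mul_sum]
  congr 1
  exact Finset.sum_congr rfl fun i _ => by ring

theorem isOpenQuotientMap_coe_unitAddTorus (d : ℕ) :
    IsOpenQuotientMap (fun (t : Fin d → ℝ) i => (t i : UnitAddCircle)) :=
  IsOpenQuotientMap.piMap fun _ => QuotientAddGroup.isOpenQuotientMap_mk

theorem exists_unitAddTorus_lift {d : ℕ} {e : Fin d → Euc d} {f : Euc d → ℂ} (hf : Continuous f)
    (hper : ∀ x j, f (x + latPt e j) = f x) :
    ∃ G : C(UnitAddTorus (Fin d), ℂ), ∀ t : Fin d → ℝ,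
      G (fun i => (t i : UnitAddCircle)) = f (∑ i, t i • e i) := by
  have hq := (isOpenQuotientMap_coe_unitAddTorus d).isQuotientMap
  let p : C(Fin d → ℝ, UnitAddTorus (Fin d)) := ⟨_, hq.continuous⟩
  have hp : Topology.IsQuotientMap p := hq
  let g : C(Fin d → ℝ, ℂ) := ⟨fun t => f (∑ i, t i • e i), by fun_prop⟩
  have hg : ∀ a b, p a = p b → g a = g b := by
    intro a b hab
    have h : ∀ i, ∃ n : ℤ, n • (1 : ℝ) = -a i + b i := fun i =>
      AddSubgroup.mem_zmultiples_iff.1 (QuotientAddGroup.eq.1 (congrFun hab i))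
    choose j hj using h
    have : ∑ i, b i • e i = ∑ i, a i • e i + latPt e j := by
      rw [latPt, ← Finset.sum_add_distrib]
      refine Finset.sum_congr rfl fun i _ => ?_
      rw [← add_smul]
      congr 1
      have := hj i
      simp at this
      linarith
    change f _ = f _
    rw [this, hper]
  refine ⟨hp.lift g hg, fun t => ?_⟩
  exact congrArg (fun k : C(Fin d → ℝ, ℂ) => k t) (hp.lift_comp g hg)

theorem hasSum_fourCoeff {d : ℕ} (b : Module.Basis (Fin d) ℝ (Euc d)) {e' : Fin d → Euc d}
    (hdual : ∀ j k, ⟪b j, e' k⟫_ℝ = if j = k then 2 * Real.pi else 0)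
    {f : Euc d → ℂ} (hf : Continuous f) (hper : ∀ x j, f (x + latPt b j) = f x)
    (hsum : Summable fun ι : Fin d → ℤ => fourCoeff b f (latPt e' ι)) (x : Euc d) :
    HasSum (fun ι : Fin d → ℤ => fourCoeff b f (latPt e' ι) *
      Complex.exp (Complex.I * (⟪x, latPt e' ι⟫_ℝ : ℂ))) (f x) := by
  obtain ⟨G, hG⟩ := exists_unitAddTorus_lift hf hper
  have hcoeff : ∀ ι, UnitAddTorus.mFourierCoeff G ι = fourCoeff b f (latPt e' ι) := by
    intro ι
    rw [fourCoeff, inv_volume_mul_setIntegral_paraSet b, UnitAddTorus.mFourierCoeff_eq_integral G ι 0]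
    have hset : {x : Fin d → ℝ | ∀ i, x i ∈ Set.Ioc ((0 : Fin d → ℝ) i) ((0 : Fin d → ℝ) i + 1)}
        =ᵐ[volume] (Set.univ.pi fun _ : Fin d => Set.Icc (0 : ℝ) 1) := by
      have h := Measure.univ_pi_Ioc_ae_eq_Icc (μ := fun _ : Fin d => (volume : Measure ℝ))
        (f := fun _ => 0) (g := fun _ => 1)
      rw [← Set.pi_univ_Icc] at h
      simpa only [Pi.zero_apply, zero_add, Set.pi, Set.mem_univ, true_imp_iff, volume_pi] using h
    rw [setIntegral_congr_set hset]
    congr 1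
    ext t
    rw [hG, UnitAddTorus.mFourier_neg, mFourier_coe_eq_cexp hdual, ← Complex.exp_conj, smul_eq_mul,
      mul_comm]
    simp
  have hG' := UnitAddTorus.hasSum_mFourier_series_apply_of_summable (f := G)
    (by simpa only [funext hcoeff] using hsum) (fun i => (b.equivFun x i : UnitAddCircle))
  simpa only [hcoeff, mFourier_coe_eq_cexp hdual, hG, b.sum_equivFun, smul_eq_mul] using hG'

theorem fderiv_tsum_cexp_apply {d : ℕ} {κ : Type*} {α : κ → Euc d} {c : κ → ℂ}
    (h0 : Summable fun k => ‖c k‖) (h1 : Summable fun k => ‖c k‖ * ‖α k‖) (x v : Euc d) :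
    fderiv ℝ (fun x => ∑' k, c k * Complex.exp (Complex.I * (⟪x, α k⟫_ℝ : ℂ))) x v =
      ∑' k, (Complex.I * (⟪v, α k⟫_ℝ : ℂ)) * c k *
        Complex.exp (Complex.I * (⟪x, α k⟫_ℝ : ℂ)) := by
  have hexp : ∀ k (y : Euc d), ‖Complex.exp (Complex.I * (⟪y, α k⟫_ℝ : ℂ))‖ = 1 := fun k y => by
    rw [Complex.norm_exp]; simp
  have hf := fun k y => (hasFDerivAt_cexp_mul_inner Complex.I (α k) y).const_mul (c k)
  have hbd : ∀ k y, ‖c k • (Complex.exp (Complex.I * (⟪y, α k⟫_ℝ : ℂ)) * Complex.I) •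
      (Complex.ofRealCLM ∘L innerSL ℝ (α k))‖ ≤ ‖c k‖ * ‖α k‖ := by
    intro k y
    rw [norm_smul, norm_smul, norm_mul, hexp, Complex.norm_I, one_mul, one_mul]
    gcongr
    refine (ContinuousLinearMap.opNorm_comp_le _ _).trans ?_
    simp
  have hsum0 : Summable fun k => c k * Complex.exp (Complex.I * (⟪x, α k⟫_ℝ : ℂ)) :=
    Summable.of_norm (by simpa only [norm_mul, hexp, mul_one] using h0)
  rw [(hasFDerivAt_tsum h1 hf hbd hsum0 x).fderiv,
    ← ContinuousLinearMap.apply_apply (𝕜 := ℝ) v,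
    ContinuousLinearMap.map_tsum _ (h1.of_norm_bounded (hbd · x))]
  refine tsum_congr fun k => ?_
  simp [real_inner_comm]
  ring

theorem pdSeq_tsum_cexp {d : ℕ} {κ : Type*} {α : κ → Euc d} (L : List (Fin d)) {c : κ → ℂ}
    (hc : ∀ n : ℕ, Summable fun k => ‖c k‖ * ‖α k‖ ^ n) :
    pdSeq L (fun x => ∑' k, c k * Complex.exp (Complex.I * (⟪x, α k⟫_ℝ : ℂ))) =
      fun x => ∑' k, (L.map fun i => Complex.I * (α k i : ℂ)).prod * c k *
        Complex.exp (Complex.I * (⟪x, α k⟫_ℝ : ℂ)) := by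
  induction L generalizing c with
  | nil => simp [pdSeq]
  | cons i L ih =>
    have h0 : Summable fun k => ‖c k‖ := by simpa using hc 0
    have h1 : Summable fun k => ‖c k‖ * ‖α k‖ := by simpa using hc 1
    simp only [pdSeq, fderiv_tsum_cexp_apply h0 h1]
    rw [ih (c := fun k => (Complex.I * (⟪EuclideanSpace.single i 1, α k⟫_ℝ : ℂ)) * c k)]
    · funext x
      refine tsum_congr fun k => ?_
      simp only [EuclideanSpace.inner_single_left, List.map_cons, List.prod_cons]
      simp
      ring
    · intro n
      refine Summable.of_nonneg_of_le (fun k => by positivity) (fun k => ?_) (hc (n + 1))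
      rw [norm_mul, norm_mul, Complex.norm_I, one_mul, Complex.norm_real, pow_succ]
      have := norm_inner_le_norm (𝕜 := ℝ) (EuclideanSpace.single i (1 : ℝ)) (α k)
      rw [PiLp.norm_single, norm_one, one_mul] at this
      calc _ ≤ ‖α k‖ * ‖c k‖ * ‖α k‖ ^ n := by gcongr
        _ = _ := by ring

theorem prod_map_mIdxL {d : ℕ} {M : Type*} [CommMonoid M] (β : Fin d → ℕ) (g : Fin d → M) :
    ((mIdxL β).map g).prod = ∏ i, g i ^ β i := by
  rw [Fin.prod_univ_def, mIdxL, List.flatMap, List.map_flatten, List.prod_flatten]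
  simp [List.map_map, Function.comp_def]

theorem latPt_injective {d : ℕ} (b : Module.Basis (Fin d) ℝ (Euc d)) :
    Function.Injective (latPt b) := by
  intro ι κ h
  have h1 : (fun i => (ι i : ℝ)) = fun i => (κ i : ℝ) :=
    b.equivFun.symm.injective (by simpa only [b.equivFun_symm_apply, latPt] using h)
  exact funext fun i => by exact_mod_cast congrFun h1 i

theorem linearIndependent_of_dual {d : ℕ} {e e' : Fin d → Euc d}
    (hdual : ∀ j k, ⟪e j, e' k⟫_ℝ = if j = k then 2 * Real.pi else 0) :
    LinearIndependent ℝ e' := by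
  refine Fintype.linearIndependent_iff.2 fun g hg j => ?_
  have h := congrArg (fun x => ⟪e j, x⟫_ℝ) hg
  simpa [inner_sum, inner_smul_right, hdual, Real.pi_ne_zero] using h

theorem summable_inv_norm_latPt_pow {d : ℕ} (b : Module.Basis (Fin d) ℝ (Euc d)) :
    Summable fun ι : Fin d → ℤ => ‖latPt b ι‖⁻¹ ^ (d + 1) := by
  have hrank : Module.finrank ℤ (Submodule.span ℤ (Set.range b)) < d + 1 := by
    have h := finrank_range_le_card (R := ℤ) b
    rw [Fintype.card_fin] at h
    exact Nat.lt_succ_of_le h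
  have h := ZLattice.summable_norm_pow_inv (Submodule.span ℤ (Set.range b)) (d + 1) hrank
  have hinj : Function.Injective fun ι : Fin d → ℤ =>
      (⟨latPt b ι, latPt_mem_span b ι⟩ : Submodule.span ℤ (Set.range b)) :=
    fun ι κ h => latPt_injective b (congrArg Subtype.val h)
  simpa [Function.comp_def] using h.comp_injective hinj

theorem summable_exp_neg_norm_latPt_rpow {d : ℕ} (b : Module.Basis (Fin d) ℝ (Euc d)) {s r : ℝ}
    (hs : 0 < s) (hr : 0 < r) :
    Summable fun ι : Fin d → ℤ => Real.exp (-r * ‖latPt b ι‖ ^ (1 / s)) := by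
  set K := ((r / s) ^ (-s)) ^ (d + 1) * ((d + 1).factorial : ℝ) ^ s
  refine Summable.of_norm_bounded_eventually ((summable_inv_norm_latPt_pow b).mul_left K) ?_
  filter_upwards [eventually_cofinite_ne (0 : Fin d → ℤ)] with ι hι
  have hne : latPt b ι ≠ 0 := fun h0 => hι (latPt_injective b (by simpa [latPt] using h0))
  have hpos : 0 < ‖latPt b ι‖ := norm_pos_iff.2 hne
  have h := pow_le_rpow_factorial_mul_exp hs (div_pos hr hs) hpos.le (d + 1)
  rw [div_mul_cancel₀ r hs.ne'] at h
  rw [Real.norm_of_nonneg (Real.exp_pos _).le, neg_mul, Real.exp_neg, inv_pow,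
    inv_le_iff_one_le_mul₀ (Real.exp_pos _), mul_right_comm, ← div_eq_mul_inv, one_le_div₀]
  · exact h
  · positivity

theorem prod_abs_pow_le {d : ℕ} (hd : 1 ≤ d) {s r : ℝ} (hs : 0 < s) (hr : 0 < r) (α : Euc d)
    (β : Fin d → ℕ) :
    ∏ i, |α i| ^ β i ≤ ((r / (d * s)) ^ (-s)) ^ (∑ i, β i) *
      (((∏ i, (β i).factorial : ℕ) : ℝ)) ^ s * Real.exp (r * ‖α‖ ^ (1 / s)) := by
  have hd0 : (0 : ℝ) < d := by exact_mod_cast hd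
  set q := r / (d * s) with hq
  have hq0 : 0 < q := by positivity
  calc ∏ i, |α i| ^ β i
      ≤ ∏ i, ((q ^ (-s)) ^ β i * ((β i).factorial : ℝ) ^ s *
          Real.exp (q * s * ‖α‖ ^ (1 / s))) := by
        refine Finset.prod_le_prod (fun i _ => by positivity) fun i _ => ?_
        refine (pow_le_rpow_factorial_mul_exp hs hq0 (abs_nonneg _) _).trans ?_
        gcongr
        exact PiLp.norm_apply_le α i
    _ = _ := by
        rw [Finset.prod_mul_distrib, Finset.prod_mul_distrib, Finset.prod_pow_eq_pow_sum,
          Real.finsetProd_rpow _ _ (fun i _ => by positivity), Finset.prod_const,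
          Finset.card_univ, Fintype.card_fin, ← Real.exp_nat_mul, Nat.cast_prod]
        congr 2
        rw [hq]
        field_simp

theorem gevrey_of_norm_fourCoeff_le {d : ℕ} (hd : 1 ≤ d) {s : ℝ} (hs : 0 < s)
    (b : Module.Basis (Fin d) ℝ (Euc d)) {e' : Fin d → Euc d}
    (hdual : ∀ j k, ⟪b j, e' k⟫_ℝ = if j = k then 2 * Real.pi else 0)
    {f : Euc d → ℂ} (hf : Continuous f) (hper : ∀ x j, f (x + latPt b j) = f x)
    {C r : ℝ} (hC : 0 < C) (hr : 0 < r)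
    (hdecay : ∀ ι : Fin d → ℤ,
      ‖fourCoeff b f (latPt e' ι)‖ ≤ C * Real.exp (-r * ‖latPt e' ι‖ ^ (1 / s))) :
    ∃ C h : ℝ, 0 < C ∧ 0 < h ∧ ∀ (β : Fin d → ℕ) (x : Euc d),
      ‖pD β f x‖ ≤ C * h ^ (∑ i, β i) * (((∏ i, (β i).factorial : ℕ) : ℝ)) ^ s := by
  have hd0 : (0 : ℝ) < d := by exact_mod_cast hd
  have : Nonempty (Fin d) := ⟨⟨0, hd⟩⟩
  have hr2 : 0 < r / 2 := half_pos hr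
  have hS : Summable fun ι : Fin d → ℤ => Real.exp (-(r / 2) * ‖latPt e' ι‖ ^ (1 / s)) := by
    simpa using summable_exp_neg_norm_latPt_rpow
      (basisOfLinearIndependentOfCardEqFinrank (linearIndependent_of_dual hdual) (by simp)) hs hr2
  set c : (Fin d → ℤ) → ℂ := fun ι => fourCoeff b f (latPt e' ι)
  have hexp : ∀ u : ℝ, Real.exp (-r * u) * Real.exp (r / 2 * u) = Real.exp (-(r / 2) * u) :=
    fun u => by rw [← Real.exp_add]; ring_nf
  have hmul : ∀ ι {A B : ℝ}, 0 ≤ A → A ≤ B * Real.exp (r / 2 * ‖latPt e' ι‖ ^ (1 / s)) →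
      ‖c ι‖ * A ≤ C * B * Real.exp (-(r / 2) * ‖latPt e' ι‖ ^ (1 / s)) := by
    intro ι A B hA hAB
    calc ‖c ι‖ * A ≤ (C * Real.exp (-r * ‖latPt e' ι‖ ^ (1 / s))) *
          (B * Real.exp (r / 2 * ‖latPt e' ι‖ ^ (1 / s))) :=
          mul_le_mul (hdecay ι) hAB hA (by positivity)
      _ = _ := by rw [← hexp]; ring
  have hcs : ∀ n : ℕ, Summable fun ι => ‖c ι‖ * ‖latPt e' ι‖ ^ n := fun n => by
    have h := fun ι => pow_le_rpow_factorial_mul_exp hs (div_pos hr2 hs)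
      (norm_nonneg (latPt e' ι)) n
    simp only [div_mul_cancel₀ _ hs.ne'] at h
    exact Summable.of_nonneg_of_le (fun ι => by positivity)
      (fun ι => hmul ι (by positivity) (h ι)) (hS.mul_left _)
  have hc0 : Summable c := Summable.of_norm (by simpa using hcs 0)
  have hfeq : f = fun x => ∑' ι, c ι * Complex.exp (Complex.I * (⟪x, latPt e' ι⟫_ℝ : ℂ)) :=
    funext fun x => (hasSum_fourCoeff b hdual hf hper hc0 x).tsum_eq.symm
  set S := ∑' ι : Fin d → ℤ, Real.exp (-(r / 2) * ‖latPt e' ι‖ ^ (1 / s))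
  have hS0 : 0 < S := hS.tsum_pos (fun _ => (Real.exp_pos _).le) 0 (Real.exp_pos _)
  refine ⟨C * S, (r / 2 / (d * s)) ^ (-s), by positivity, by positivity, fun β x => ?_⟩
  have hpD : pD β f x = ∑' ι, ((mIdxL β).map fun i => Complex.I * (latPt e' ι i : ℂ)).prod * c ι *
      Complex.exp (Complex.I * (⟪x, latPt e' ι⟫_ℝ : ℂ)) := by
    rw [pD, hfeq, pdSeq_tsum_cexp _ hcs]
  rw [hpD]
  refine (tsum_of_norm_bounded (hS.hasSum.mul_left _) fun ι => ?_).trans_eq (b := C *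
    (((r / 2 / (d * s)) ^ (-s)) ^ (∑ i, β i) * (((∏ i, (β i).factorial : ℕ) : ℝ)) ^ s) * S) ?_
  · have h1 : ‖Complex.exp (Complex.I * (⟪x, latPt e' ι⟫_ℝ : ℂ))‖ = 1 := by
      rw [Complex.norm_exp]; simp
    rw [norm_mul, h1, mul_one, norm_mul, prod_map_mIdxL, norm_prod, mul_comm]
    simp only [norm_pow, norm_mul, Complex.norm_I, one_mul, Complex.norm_real, Real.norm_eq_abs]
    exact hmul ι (by positivity) (prod_abs_pow_le hd hs hr2 _ β)
  · ring

/-- A smooth `E`-periodic function satisfies a Roumieu–Gevrey-`s` bound on all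
its partial derivatives iff its Fourier coefficients decay like `C e^{-r|α|^{1/s}}`. -/
theorem periodic_gevrey_roumieu_iff_coeff_decay
    {d : ℕ} (hd : 1 ≤ d) (s : ℝ) (hs : 0 < s)
    (e e' : Fin d → Euc d) (he : LinearIndependent ℝ e)
    (hdual : ∀ j k, ⟪e j, e' k⟫_ℝ = if j = k then 2 * Real.pi else 0)
    (f : Euc d → ℂ) (hf : ContDiff ℝ (⊤ : ℕ∞) f)
    (hper : ∀ (x : Euc d) (j : Fin d → ℤ), f (x + latPt e j) = f x) :
    (∃ C h : ℝ, 0 < C ∧ 0 < h ∧ ∀ (β : Fin d → ℕ) (x : Euc d),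
        ‖pD β f x‖ ≤ C * h ^ (∑ i, β i) * (((∏ i, (β i).factorial : ℕ) : ℝ)) ^ s)
    ↔
    (∃ C r : ℝ, 0 < C ∧ 0 < r ∧ ∀ ι : Fin d → ℤ,
        ‖fourCoeff e f (latPt e' ι)‖ ≤ C * Real.exp (-r * ‖latPt e' ι‖ ^ (1/s))) := by

  have : Nonempty (Fin d) := ⟨⟨0, hd⟩⟩
  obtain ⟨b, rfl⟩ : ∃ b : Module.Basis (Fin d) ℝ (Euc d), ⇑b = e :=
    ⟨basisOfLinearIndependentOfCardEqFinrank he (by simp), by simp⟩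
  constructor
  · rintro ⟨C, h, hC, hh, hbound⟩
    have hd0 : (0 : ℝ) < d := by exact_mod_cast hd
    refine ⟨2 ^ s * C, s / 2 / (d * h) ^ (1 / s), by positivity, by positivity, fun ι => ?_⟩
    refine (le_exp_of_forall_mul_pow_le hs (norm_nonneg _) hC.le (by positivity)
      (norm_fourCoeff_mul_pow_le hd b hdual hf hper hh hbound ι)).trans_eq ?_
    rw [Real.div_rpow (norm_nonneg _) (by positivity)]
    ring_nf
  · rintro ⟨C, r, hC, hr, hdecay⟩
    exact gevrey_of_norm_fourCoeff_le hd hs b hdual hf.continuous hper hC hr hdecay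

end
end

section
/- Let d ≥ 1, s, t > 0 with s + t ≥ 1, E ⊆ ℝ^d be a non-degenerate parallelepiped, and let φ : ℝ^d → ℂ be a nonzero continuous integrable function such that for every r₀ > 0 there is a constant C₀ > 0 with |φ(x)| ≤ C₀ e^{-r₀|x|^{1/t}} and |φ̂(ξ)| ≤ C₀ e^{-r₀|ξ|^{1/s}} for all x, ξ ∈ ℝ^d. Let f be a smooth E-periodic function on ℝ^d. Then the following are equivalent: (i) for every r > 0 there exists C > 0 with |V_φf(x,ξ)| ≤ C e^{-r|ξ|^{1/s}} for all (x,ξ); (ii) for every r' > 0 there exists C' > 0 with |c(f,α)| ≤ C' e^{-r'|α|^{1/s}} for all α ∈ Λ'_E. -/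
open MeasureTheory Filter
open scoped BigOperators InnerProductSpace Topology

noncomputable section

open Set

/-- The half-open unit cube with lower corner `a`. -/
def unitCube {d : ℕ} (a : Fin d → ℝ) : Set (Fin d → ℝ) :=
  {x | ∀ i, x i ∈ Ioc (a i) (a i + 1)}

/-- The coordinate map `t ↦ ∑ i, t i • e i` as a continuous linear equivalence. -/
def coordEquiv {d : ℕ} (e : Fin d → Euc d) (he : LinearIndependent ℝ e) :
    (Fin d → ℝ) ≃L[ℝ] Euc d :=
  (Module.Basis.mk he (he.span_eq_top_of_card_eq_finrank' (by simp)).ge).equivFunL.symm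

lemma coordEquiv_apply {d : ℕ} (e : Fin d → Euc d) (he : LinearIndependent ℝ e) (x : Fin d → ℝ) :
    coordEquiv e he x = ∑ i, x i • e i := by
  change (Module.Basis.mk he _).equivFun.symm x = _
  simp [Module.Basis.equivFun_symm_apply]

lemma unitCube_eq_pi {d : ℕ} (a : Fin d → ℝ) :
    unitCube a = univ.pi fun i => Ioc (a i) (a i + 1) := by
  ext; simp [unitCube]

lemma measurableSet_unitCube {d : ℕ} (a : Fin d → ℝ) : MeasurableSet (unitCube a) := by
  rw [unitCube_eq_pi]
  exact MeasurableSet.univ_pi fun _ => measurableSet_Ioc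

lemma volume_unitCube {d : ℕ} (a : Fin d → ℝ) : volume (unitCube a) = 1 := by
  rw [unitCube_eq_pi, volume_pi_pi]
  simp

lemma fourCoeff_eq_setIntegral_unitCube {d : ℕ} (e : Fin d → Euc d) (he : LinearIndependent ℝ e)
    (f : Euc d → ℂ) (ξ : Euc d) :
    fourCoeff e f ξ = ∫ x in unitCube (0 : Fin d → ℝ), f (coordEquiv e he x) *
      Complex.exp (-Complex.I * (⟪coordEquiv e he x, ξ⟫_ℝ : ℂ)) := by
  set L := coordEquiv e he with hL
  have hpara : paraSet e = L '' (univ.pi fun _ => Icc (0:ℝ) 1) := by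
    ext y; simp [paraSet, hL, coordEquiv_apply]
  have hmap : (volume.map L).IsAddHaarMeasure := L.isAddHaarMeasure_map volume
  obtain ⟨c, hc0, hctop, hc⟩ : ∃ c : ENNReal, c ≠ 0 ∧ c ≠ ⊤ ∧
      (volume : Measure (Euc d)) = c • volume.map L := by
    refine ⟨Measure.addHaarScalarFactor (volume : Measure (Euc d)) (volume.map L), ?_, by simp, ?_⟩
    · simpa using (Measure.addHaarScalarFactor_pos_of_isAddHaarMeasure
        (volume : Measure (Euc d)) (volume.map L)).ne'
    · exact Measure.isAddLeftInvariant_eq_smul (volume : Measure (Euc d)) (volume.map L)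
  have hLe : MeasurableEmbedding L := L.toHomeomorph.measurableEmbedding
  have hvol : volume (paraSet e) = c := by
    rw [hc, Measure.smul_apply, hLe.map_apply, hpara, preimage_image_eq _ L.injective,
      volume_pi_pi]
    simp
  have hae : (unitCube (0 : Fin d → ℝ)) =ᵐ[volume] univ.pi fun _ => Icc (0:ℝ) 1 := by
    rw [unitCube_eq_pi]
    simpa [volume_pi] using Measure.univ_pi_Ioc_ae_eq_Icc (μ := fun _ : Fin d => (volume : Measure ℝ))
      (f := fun _ => 0) (g := fun _ => 1)
  rw [fourCoeff, hvol, hc, Measure.restrict_smul, integral_smul_measure, hLe.setIntegral_map, hpara,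
    preimage_image_eq _ L.injective, setIntegral_congr_set hae, Complex.real_smul, ← mul_assoc,
    inv_mul_cancel₀, one_mul]
  exact_mod_cast (ENNReal.toReal_pos hc0 hctop).ne'

lemma exists_torus_lift {d : ℕ} (e : Fin d → Euc d) (he : LinearIndependent ℝ e)
    {f : Euc d → ℂ} (hf : Continuous f)
    (hper : ∀ (x : Euc d) (j : Fin d → ℤ), f (x + latPt e j) = f x) :
    ∃ F : C(UnitAddTorus (Fin d), ℂ), ∀ x : Fin d → ℝ,
      F (fun i => (x i : UnitAddCircle)) = f (coordEquiv e he x) := by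
  have hq : IsOpenQuotientMap (Pi.map fun (_ : Fin d) (x : ℝ) => (x : UnitAddCircle)) :=
    .piMap fun _ => QuotientAddGroup.isOpenQuotientMap_mk
  have hval (x : Fin d → ℝ) : f (coordEquiv e he (fun i => Quotient.out (x i : UnitAddCircle)))
      = f (coordEquiv e he x) := by
    have (i : Fin d) : ∃ n : ℤ, Quotient.out (x i : UnitAddCircle) = x i + n := by
      have h : ((Quotient.out (x i : UnitAddCircle) : ℝ) : UnitAddCircle) = x i :=
        Quotient.out_eq' _
      obtain ⟨n, hn⟩ := (QuotientAddGroup.eq_iff_sub_mem.mp h)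
      exact ⟨n, by simp at hn; linarith⟩
    choose n hn using this
    rw [← hper (coordEquiv e he x) n]
    congr 1
    simp [coordEquiv_apply, latPt, hn, add_smul, Finset.sum_add_distrib]
  refine ⟨⟨fun z => f (coordEquiv e he fun i => Quotient.out (z i)), ?_⟩, hval⟩
  rw [hq.isQuotientMap.continuous_iff]
  exact (hf.comp (coordEquiv e he).continuous).congr fun x => (hval x).symm

lemma inner_coordEquiv_latPt {d : ℕ} {e e' : Fin d → Euc d} (he : LinearIndependent ℝ e)
    (hdual : ∀ j k, ⟪e j, e' k⟫_ℝ = if j = k then 2 * Real.pi else 0)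
    (x : Fin d → ℝ) (ι : Fin d → ℤ) :
    ⟪coordEquiv e he x, latPt e' ι⟫_ℝ = ∑ i, 2 * Real.pi * (ι i * x i) := by
  simp [coordEquiv_apply, latPt, sum_inner, inner_sum, inner_smul_left, inner_smul_right, hdual]
  exact Finset.sum_congr rfl fun i _ => by ring

lemma mFourier_coe_eq {d : ℕ} {e e' : Fin d → Euc d} (he : LinearIndependent ℝ e)
    (hdual : ∀ j k, ⟪e j, e' k⟫_ℝ = if j = k then 2 * Real.pi else 0)
    (x : Fin d → ℝ) (ι : Fin d → ℤ) :
    UnitAddTorus.mFourier ι (fun i => (x i : UnitAddCircle)) =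
      Complex.exp (Complex.I * (⟪coordEquiv e he x, latPt e' ι⟫_ℝ : ℂ)) := by
  rw [inner_coordEquiv_latPt he hdual, UnitAddTorus.mFourier]
  simp only [ContinuousMap.coe_mk, fourier_coe_apply]
  rw [← Complex.exp_sum]
  push_cast
  rw [Finset.mul_sum]
  congr 1
  exact Finset.sum_congr rfl fun i _ => by ring

lemma mFourierCoeff_eq_setIntegral {d : ℕ} {e e' : Fin d → Euc d} (he : LinearIndependent ℝ e)
    (hdual : ∀ j k, ⟪e j, e' k⟫_ℝ = if j = k then 2 * Real.pi else 0)
    {f : Euc d → ℂ} {F : C(UnitAddTorus (Fin d), ℂ)}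
    (hF : ∀ x : Fin d → ℝ, F (fun i => (x i : UnitAddCircle)) = f (coordEquiv e he x))
    (ι : Fin d → ℤ) (a : Fin d → ℝ) :
    UnitAddTorus.mFourierCoeff F ι = ∫ x in unitCube a, f (coordEquiv e he x) *
      Complex.exp (-Complex.I * (⟪coordEquiv e he x, latPt e' ι⟫_ℝ : ℂ)) := by
  rw [UnitAddTorus.mFourierCoeff_eq_integral F ι a]
  refine setIntegral_congr_fun (measurableSet_unitCube a) fun x _ => ?_
  have hneg : latPt e' (-ι) = -latPt e' ι := by simp [latPt]
  simp only [hF, mFourier_coe_eq he hdual, smul_eq_mul]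
  rw [mul_comm, hneg, inner_neg_right, Complex.ofReal_neg, mul_neg, neg_mul]

lemma mFourierCoeff_eq_fourCoeff {d : ℕ} {e e' : Fin d → Euc d} (he : LinearIndependent ℝ e)
    (hdual : ∀ j k, ⟪e j, e' k⟫_ℝ = if j = k then 2 * Real.pi else 0)
    {f : Euc d → ℂ} {F : C(UnitAddTorus (Fin d), ℂ)}
    (hF : ∀ x : Fin d → ℝ, F (fun i => (x i : UnitAddCircle)) = f (coordEquiv e he x))
    (ι : Fin d → ℤ) :
    UnitAddTorus.mFourierCoeff F ι = fourCoeff e f (latPt e' ι) := by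
  rw [fourCoeff_eq_setIntegral_unitCube e he, mFourierCoeff_eq_setIntegral he hdual hF ι 0]

lemma setIntegral_unitCube_translate {d : ℕ} {e e' : Fin d → Euc d} (he : LinearIndependent ℝ e)
    (hdual : ∀ j k, ⟪e j, e' k⟫_ℝ = if j = k then 2 * Real.pi else 0)
    {f : Euc d → ℂ} (hf : Continuous f)
    (hper : ∀ (x : Euc d) (j : Fin d → ℤ), f (x + latPt e j) = f x)
    (ι : Fin d → ℤ) (y : Euc d) :
    ∫ x in unitCube (0 : Fin d → ℝ), f (coordEquiv e he x + y) *
      Complex.exp (-Complex.I * (⟪coordEquiv e he x, latPt e' ι⟫_ℝ : ℂ)) =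
    Complex.exp (Complex.I * (⟪y, latPt e' ι⟫_ℝ : ℂ)) * fourCoeff e f (latPt e' ι) := by
  obtain ⟨F, hF⟩ := exists_torus_lift e he hf hper
  obtain ⟨s, rfl⟩ := (coordEquiv e he).surjective y
  rw [← mFourierCoeff_eq_fourCoeff he hdual hF, mFourierCoeff_eq_setIntegral he hdual hF ι s]
  have hpre : (fun x => x + s) ⁻¹' unitCube s = unitCube (0 : Fin d → ℝ) := by
    ext x
    simp only [unitCube, mem_preimage, mem_ofPred_eq, Pi.add_apply, Pi.zero_apply, mem_Ioc]
    refine forall_congr' fun i => ⟨fun h => ⟨by linarith [h.1], by linarith [h.2]⟩,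
      fun h => ⟨by linarith [h.1], by linarith [h.2]⟩⟩
  rw [← (measurePreserving_add_right volume s).setIntegral_preimage_emb
    (measurableEmbedding_addRight s) _ (unitCube s), hpre, ← integral_const_mul]
  refine setIntegral_congr_fun (measurableSet_unitCube 0) fun x _ => ?_
  simp only [map_add, inner_add_left]
  rw [mul_left_comm, ← Complex.exp_add]
  congr 2
  push_cast
  ring

lemma exists_FT_ne_zero {d : ℕ} {φ : Euc d → ℂ} (hφc : Continuous φ) (hφi : Integrable φ)
    (hφne : φ ≠ 0) : ∃ ξ, FT φ ξ ≠ 0 := by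
  by_contra! h
  apply hφne
  have h0 : FourierTransform.fourier φ = 0 := by
    ext w
    have := h ((2 * Real.pi) • w)
    rw [FT, mul_eq_zero] at this
    rcases this with h1 | h1
    · exact absurd (Complex.ofReal_eq_zero.mp h1) (by positivity)
    · rw [Real.fourier_eq', Pi.zero_apply, ← h1]
      congr 1
      ext v
      rw [smul_eq_mul, mul_comm, inner_smul_right]
      congr 2
      push_cast
      ring
  have := hφc.fourierInv_fourier_eq hφi (by rw [h0]; exact integrable_zero _ _ _)
  rw [← this, h0]
  ext w
  simp [Real.fourierInv_eq]

lemma integral_conj_translate_mul_exp {d : ℕ} (φ : Euc d → ℂ) (x ξ α : Euc d) :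
    (((2 * Real.pi) ^ (-(d:ℝ)/2) : ℝ) : ℂ) *
      ∫ y, (starRingEnd ℂ) (φ (y - x)) * (Complex.exp (-Complex.I * (⟪y, ξ⟫_ℝ : ℂ)) *
        Complex.exp (Complex.I * (⟪y, α⟫_ℝ : ℂ))) =
    Complex.exp (Complex.I * (⟪x, α - ξ⟫_ℝ : ℂ)) * (starRingEnd ℂ) (FT φ (α - ξ)) := by
  rw [FT, map_mul, Complex.conj_ofReal, ← integral_conj, mul_left_comm]
  congr 1
  rw [← integral_const_mul, ← integral_add_right_eq_self _ x]
  congr 1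
  ext y
  rw [add_sub_cancel_right, map_mul, ← Complex.exp_conj,
    mul_left_comm (Complex.exp (Complex.I * _)), ← Complex.exp_add, ← Complex.exp_add]
  congr 2
  simp only [map_mul, map_neg, Complex.conj_I, Complex.conj_ofReal, inner_add_left,
    inner_sub_right]
  push_cast
  ring

lemma STFT_eq_integral_add {d : ℕ} (φ f : Euc d → ℂ) (x ξ : Euc d) :
    STFT φ f x ξ = Complex.exp (-Complex.I * (⟪x, ξ⟫_ℝ : ℂ)) *
      ((((2 * Real.pi) ^ (-(d:ℝ)/2) : ℝ) : ℂ) *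
      ∫ y, f (x + y) * (starRingEnd ℂ) (φ y) * Complex.exp (-Complex.I * (⟪y, ξ⟫_ℝ : ℂ))) := by
  rw [STFT, mul_left_comm]
  congr 1
  rw [← integral_const_mul, ← integral_add_left_eq_self _ x]
  congr 1
  ext y
  rw [add_sub_cancel_left, inner_add_left, Complex.ofReal_add, mul_add, Complex.exp_add]
  ring

lemma norm_exp_I_mul_ofReal_left (a : ℝ) : ‖Complex.exp (Complex.I * a)‖ = 1 := by
  rw [mul_comm, Complex.norm_exp_ofReal_mul_I]

lemma norm_exp_neg_I_mul_ofReal_left (a : ℝ) : ‖Complex.exp (-Complex.I * a)‖ = 1 := by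
  rw [neg_mul, ← mul_neg, ← Complex.ofReal_neg, norm_exp_I_mul_ofReal_left]

lemma exists_norm_le_of_periodic {d : ℕ} {e : Fin d → Euc d} (he : LinearIndependent ℝ e)
    {f : Euc d → ℂ} (hf : Continuous f)
    (hper : ∀ (x : Euc d) (j : Fin d → ℤ), f (x + latPt e j) = f x) :
    ∃ M, ∀ x, ‖f x‖ ≤ M := by
  obtain ⟨F, hF⟩ := exists_torus_lift e he hf hper
  refine ⟨‖F‖, fun x => ?_⟩
  obtain ⟨s, rfl⟩ := (coordEquiv e he).surjective x
  rw [← hF]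
  exact F.norm_coe_le_norm _

lemma norm_fourCoeff_mul_norm_FT_le {d : ℕ} {e e' : Fin d → Euc d} (he : LinearIndependent ℝ e)
    (hdual : ∀ j k, ⟪e j, e' k⟫_ℝ = if j = k then 2 * Real.pi else 0)
    {φ : Euc d → ℂ} (hφi : Integrable φ)
    {f : Euc d → ℂ} (hf : Continuous f)
    (hper : ∀ (x : Euc d) (j : Fin d → ℤ), f (x + latPt e j) = f x)
    {ξ : Euc d} {B : ℝ} (hB : ∀ x, ‖STFT φ f x ξ‖ ≤ B) (ι : Fin d → ℤ) :
    ‖fourCoeff e f (latPt e' ι)‖ * ‖FT φ (latPt e' ι - ξ)‖ ≤ B := by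
  set α := latPt e' ι
  set L := coordEquiv e he with hL
  set κ : ℂ := (((2 * Real.pi) ^ (-(d:ℝ)/2) : ℝ) : ℂ)
  set χ : Euc d → ℂ := fun x => Complex.exp (-Complex.I * (⟪x, α⟫_ℝ : ℂ)) with hχ
  set ψ : Euc d → ℂ := fun y =>
    (starRingEnd ℂ) (φ y) * Complex.exp (-Complex.I * (⟪y, ξ⟫_ℝ : ℂ)) with hψ
  have hψi : Integrable ψ := by
    refine ((LinearIsometryEquiv.integrable_comp_iff Complex.conjLIE).mpr hφi).mul_bdd (c := 1)
      (Continuous.aestronglyMeasurable (by fun_prop)) (ae_of_all _ fun y => ?_)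
    rw [norm_exp_neg_I_mul_ofReal_left]
  obtain ⟨M, hM⟩ := exists_norm_le_of_periodic he hf hper
  have : IsFiniteMeasure (volume.restrict (unitCube (0 : Fin d → ℝ))) :=
    ⟨by simp [volume_unitCube]⟩
  have hint : Integrable (Function.uncurry fun (x : Fin d → ℝ) (y : Euc d) =>
      (f (L x + y) * χ (L x)) * ψ y)
      ((volume.restrict (unitCube (0 : Fin d → ℝ))).prod volume) := by
    refine (hψi.comp_snd _).bdd_mul (c := M)
      (f := fun p : (Fin d → ℝ) × Euc d => f (L p.1 + p.2) * χ (L p.1))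
      (Continuous.aestronglyMeasurable (by fun_prop)) (ae_of_all _ fun p => ?_)
    rw [norm_mul, hχ, norm_exp_neg_I_mul_ofReal_left, mul_one]
    exact hM _
  have hswap := integral_integral_swap hint
  have hright : κ * ∫ y, ∫ x in unitCube (0 : Fin d → ℝ), (f (L x + y) * χ (L x)) * ψ y =
      fourCoeff e f α * (starRingEnd ℂ) (FT φ (α - ξ)) := by
    have h0 := integral_conj_translate_mul_exp φ 0 ξ α
    simp only [sub_zero, inner_zero_left, Complex.ofReal_zero, mul_zero, Complex.exp_zero,
      one_mul] at h0
    rw [← h0, mul_left_comm]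
    congr 1
    rw [← integral_const_mul]
    congr 1
    ext y
    rw [integral_mul_const, setIntegral_unitCube_translate he hdual hf hper ι y]
    ring
  have hleft : ‖κ * ∫ x in unitCube (0 : Fin d → ℝ), ∫ y, (f (L x + y) * χ (L x)) * ψ y‖ ≤ B := by
    rw [← integral_const_mul]
    have := norm_setIntegral_le_of_norm_le_const (μ := volume) (s := unitCube (0 : Fin d → ℝ))
      (f := fun x => κ * ∫ y, (f (L x + y) * χ (L x)) * ψ y) (C := B)
      (by simp [volume_unitCube]) fun x _ => ?_
    · simpa [Measure.real, volume_unitCube] using this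
    · have hpull : ∫ y, (f (L x + y) * χ (L x)) * ψ y = χ (L x) *
          ∫ y, f (L x + y) * (starRingEnd ℂ) (φ y) *
            Complex.exp (-Complex.I * (⟪y, ξ⟫_ℝ : ℂ)) := by
        rw [← integral_const_mul]
        congr 1
        ext y
        simp only [hψ]
        ring
      refine le_trans (le_of_eq ?_) (hB (L x))
      rw [STFT_eq_integral_add, norm_mul (Complex.exp _), norm_exp_neg_I_mul_ofReal_left, one_mul,
        hpull, mul_left_comm, norm_mul (χ _), hχ, norm_exp_neg_I_mul_ofReal_left, one_mul]
  rw [hswap, hright, norm_mul, RCLike.norm_conj] at hleft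
  exact hleft

lemma norm_STFT_le_tsum {d : ℕ} {e e' : Fin d → Euc d} (he : LinearIndependent ℝ e)
    (hdual : ∀ j k, ⟪e j, e' k⟫_ℝ = if j = k then 2 * Real.pi else 0)
    {φ : Euc d → ℂ} (hφi : Integrable φ)
    {f : Euc d → ℂ} (hf : Continuous f)
    (hper : ∀ (x : Euc d) (j : Fin d → ℤ), f (x + latPt e j) = f x)
    (hsum : Summable fun ι : Fin d → ℤ => ‖fourCoeff e f (latPt e' ι)‖) {b : (Fin d → ℤ) → ℝ}
    (hb : Summable b) (x ξ : Euc d)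
    (hle : ∀ ι, ‖fourCoeff e f (latPt e' ι)‖ * ‖FT φ (latPt e' ι - ξ)‖ ≤ b ι) :
    ‖STFT φ f x ξ‖ ≤ ∑' ι, b ι := by
  obtain ⟨F, hF⟩ := exists_torus_lift e he hf hper
  have hser (y : Euc d) : HasSum (fun ι : Fin d → ℤ => fourCoeff e f (latPt e' ι) *
      Complex.exp (Complex.I * (⟪y, latPt e' ι⟫_ℝ : ℂ))) (f y) := by
    obtain ⟨s, rfl⟩ := (coordEquiv e he).surjective y
    have := UnitAddTorus.hasSum_mFourier_series_apply_of_summable (f := F)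
      (Summable.of_norm (by simpa only [mFourierCoeff_eq_fourCoeff he hdual hF] using hsum))
      (fun i => (s i : UnitAddCircle))
    simpa only [mFourierCoeff_eq_fourCoeff he hdual hF, mFourier_coe_eq he hdual, hF,
      smul_eq_mul] using this
  set T : (Fin d → ℤ) → Euc d → ℂ := fun ι y => fourCoeff e f (latPt e' ι) *
    ((starRingEnd ℂ) (φ (y - x)) * (Complex.exp (-Complex.I * (⟪y, ξ⟫_ℝ : ℂ)) *
        Complex.exp (Complex.I * (⟪y, latPt e' ι⟫_ℝ : ℂ)))) with hT
  have hφx : Integrable fun y => (starRingEnd ℂ) (φ (y - x)) :=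
    (LinearIsometryEquiv.integrable_comp_iff Complex.conjLIE).mpr (hφi.comp_sub_right x)
  have hTi (ι : Fin d → ℤ) : Integrable (T ι) := by
    refine (hφx.mul_bdd (c := 1) (Continuous.aestronglyMeasurable (by fun_prop))
      (ae_of_all _ fun y => ?_)).const_mul _
    rw [norm_mul, norm_exp_neg_I_mul_ofReal_left, norm_exp_I_mul_ofReal_left, one_mul]
  have hTn (ι : Fin d → ℤ) (y : Euc d) : ‖T ι y‖ =
      ‖fourCoeff e f (latPt e' ι)‖ * ‖φ (y - x)‖ := by
    simp only [hT, norm_mul, norm_exp_neg_I_mul_ofReal_left, norm_exp_I_mul_ofReal_left, mul_one,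
      RCLike.norm_conj]
  have hmain := hasSum_integral_of_summable_integral_norm hTi (by
    simp only [hTn, integral_const_mul]
    exact hsum.mul_right _)
  have heq : (fun y => ∑' ι, T ι y) = fun y => f y * (starRingEnd ℂ) (φ (y - x)) *
      Complex.exp (-(Complex.I) * (⟪y, ξ⟫_ℝ : ℂ)) := by
    ext y
    rw [← ((hser y).mul_right ((starRingEnd ℂ) (φ (y - x)) *
      Complex.exp (-(Complex.I) * (⟪y, ξ⟫_ℝ : ℂ)))).tsum_eq.trans (mul_assoc _ _ _).symm]
    refine tsum_congr fun ι => ?_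
    simp only [hT]
    ring
  rw [heq] at hmain
  have h2 := hmain.mul_left (((2 * Real.pi) ^ (-(d:ℝ)/2) : ℝ) : ℂ)
  rw [← STFT] at h2
  rw [← h2.tsum_eq]
  refine tsum_of_norm_bounded hb.hasSum fun ι => ?_
  refine le_trans (le_of_eq ?_) (hle ι)
  simp only [hT]
  rw [integral_const_mul, mul_left_comm, integral_conj_translate_mul_exp, norm_mul, norm_mul,
    norm_exp_I_mul_ofReal_left, one_mul, RCLike.norm_conj]

lemma exists_norm_le_mul_norm_latPt {d : ℕ} {e e' : Fin d → Euc d}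
    (hdual : ∀ j k, ⟪e j, e' k⟫_ℝ = if j = k then 2 * Real.pi else 0) :
    ∃ M > 0, ∀ ι : Fin d → ℤ, ‖fun i => (ι i : ℝ)‖ ≤ M * ‖latPt e' ι‖ := by
  refine ⟨∑ i, ‖e i‖ + 1, by positivity, fun ι => ?_⟩
  refine (pi_norm_le_iff_of_nonneg (by positivity)).mpr fun i => ?_
  have h1 : ⟪e i, latPt e' ι⟫_ℝ = 2 * Real.pi * ι i := by
    simp [latPt, inner_sum, inner_smul_right, hdual, mul_comm]
  have h2 := abs_real_inner_le_norm (e i) (latPt e' ι)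
  rw [h1, abs_mul, abs_of_pos Real.two_pi_pos] at h2
  have h3 : ‖e i‖ ≤ ∑ i, ‖e i‖ :=
    Finset.single_le_sum (f := fun i => ‖e i‖) (fun _ _ => norm_nonneg _) (Finset.mem_univ i)
  have h4 : 1 ≤ 2 * Real.pi := by linarith [Real.pi_gt_three]
  calc ‖(ι i : ℝ)‖ ≤ 2 * Real.pi * |(ι i : ℝ)| := by
        rw [Real.norm_eq_abs]; exact le_mul_of_one_le_left (abs_nonneg _) h4
    _ ≤ ‖e i‖ * ‖latPt e' ι‖ := h2
    _ ≤ _ := by gcongr; linarith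

lemma summable_int_norm_rpow {d : ℕ} {r : ℝ} (hr : r < -d) :
    Summable fun ι : Fin d → ℤ => ‖fun i => (ι i : ℝ)‖ ^ r := by
  have hfin : Module.finrank ℤ (Submodule.span ℤ (range (Pi.basisFun ℝ (Fin d)))) = d := by
    rw [ZLattice.rank ℝ]; simp
  have hmem (ι : Fin d → ℤ) :
      (fun i => (ι i : ℝ)) ∈ Submodule.span ℤ (range (Pi.basisFun ℝ (Fin d))) :=
    (Module.Basis.mem_span_iff_repr_mem ℤ (Pi.basisFun ℝ (Fin d)) _).mpr fun i => ⟨ι i, by simp⟩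
  have hsum := ZLattice.summable_norm_rpow (Submodule.span ℤ (range (Pi.basisFun ℝ (Fin d)))) r
    (by rwa [hfin])
  have hinj : Function.Injective fun ι : Fin d → ℤ =>
      (⟨fun i => (ι i : ℝ), hmem ι⟩ : Submodule.span ℤ (range (Pi.basisFun ℝ (Fin d)))) := by
    intro a b hab
    have hab := congrArg Subtype.val hab
    ext i
    exact Int.cast_injective (congrFun hab i)
  refine (hsum.comp_injective hinj).congr fun ι => ?_
  rfl

lemma summable_exp_neg_norm_latPt_rpow_s8 {d : ℕ} {e e' : Fin d → Euc d}
    (hdual : ∀ j k, ⟪e j, e' k⟫_ℝ = if j = k then 2 * Real.pi else 0) {p : ℝ} (hp : 0 < p) :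
    Summable fun ι : Fin d → ℤ => Real.exp (-‖latPt e' ι‖ ^ p) := by
  obtain ⟨M, hM, hle⟩ := exists_norm_le_mul_norm_latPt hdual
  obtain ⟨n, hn⟩ := exists_nat_gt (d / p)
  rw [div_lt_iff₀ hp] at hn
  refine ((summable_int_norm_rpow (d := d) (r := -(n * p)) (by linarith)).mul_left
    (n.factorial * (M ^ p) ^ n)).of_norm_bounded_eventually ?_
  filter_upwards [(finite_singleton (0 : Fin d → ℤ)).compl_mem_cofinite] with ι hι
  have hpos : 0 < ‖fun i => (ι i : ℝ)‖ := by
    refine norm_pos_iff.mpr fun h => hι ?_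
    ext i
    simpa using congrFun h i
  have h1 : ‖fun i => (ι i : ℝ)‖ ^ p ≤ M ^ p * ‖latPt e' ι‖ ^ p := by
    rw [← Real.mul_rpow hM.le (norm_nonneg _)]
    exact Real.rpow_le_rpow hpos.le (hle ι) hp.le
  have h2 := Real.pow_div_factorial_le_exp (x := ‖latPt e' ι‖ ^ p) (by positivity) n
  have h3 : (‖fun i => (ι i : ℝ)‖ ^ p) ^ n ≤
      (M ^ p) ^ n * (n.factorial * Real.exp (‖latPt e' ι‖ ^ p)) := by
    refine (pow_le_pow_left₀ (by positivity) h1 n).trans ?_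
    rw [mul_pow]
    gcongr
    rwa [div_le_iff₀' (by positivity)] at h2
  rw [Real.norm_of_nonneg (Real.exp_pos _).le, Real.exp_neg, Real.rpow_neg hpos.le, mul_comm (n : ℝ),
    Real.rpow_mul hpos.le, Real.rpow_natCast, inv_le_iff_one_le_mul₀ (Real.exp_pos _),
    mul_right_comm, le_mul_inv_iff₀ (by positivity), one_mul]
  linarith

lemma add_rpow_le_two_rpow_mul {a b p : ℝ} (ha : 0 ≤ a) (hb : 0 ≤ b) (hp : 0 ≤ p) :
    (a + b) ^ p ≤ 2 ^ p * (a ^ p + b ^ p) := by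
  have h : a + b ≤ 2 * max a b := by linarith [le_max_left a b, le_max_right a b]
  refine (Real.rpow_le_rpow (by positivity) h hp).trans ?_
  rw [Real.mul_rpow (by norm_num) (by positivity)]
  gcongr
  rcases max_cases a b with ⟨h, _⟩ | ⟨h, _⟩ <;> rw [h]
  · linarith [Real.rpow_nonneg hb p]
  · linarith [Real.rpow_nonneg ha p]

lemma norm_rpow_le_two_rpow_mul {V : Type*} [NormedAddCommGroup V] (x y : V) {p : ℝ}
    (hp : 0 ≤ p) : ‖x‖ ^ p ≤ 2 ^ p * (‖y‖ ^ p + ‖y - x‖ ^ p) := by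
  refine le_trans ?_ (add_rpow_le_two_rpow_mul (norm_nonneg y) (norm_nonneg (y - x)) hp)
  refine Real.rpow_le_rpow (norm_nonneg _) ?_ hp
  simpa using norm_sub_le y (y - x)

/-- Beurling case: for a smooth `E`-periodic `f` and a Beurling Gelfand–Shilov-type
window `φ`, the STFT satisfies `|V_φf(x,ξ)| ≤ C e^{-r|ξ|^{1/s}}` for every `r > 0` iff the Fourier
coefficients satisfy `|c(f,α)| ≤ C' e^{-r'|α|^{1/s}}` for every `r' > 0`. -/
theorem stft_decay_iff_coeff_decay_beurling
    {d : ℕ} (hd : 1 ≤ d) (s t : ℝ) (hs : 0 < s) (ht : 0 < t) (hst : 1 ≤ s + t)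
    (e e' : Fin d → Euc d) (he : LinearIndependent ℝ e)
    (hdual : ∀ j k, ⟪e j, e' k⟫_ℝ = if j = k then 2 * Real.pi else 0)
    (φ : Euc d → ℂ) (hφc : Continuous φ) (hφi : MeasureTheory.Integrable φ) (hφne : φ ≠ 0)
    (hφ : ∀ r₀ : ℝ, 0 < r₀ → ∃ C₀ : ℝ, 0 < C₀ ∧
      (∀ x : Euc d, ‖φ x‖ ≤ C₀ * Real.exp (-r₀ * ‖x‖ ^ (1/t))) ∧
      (∀ ξ : Euc d, ‖FT φ ξ‖ ≤ C₀ * Real.exp (-r₀ * ‖ξ‖ ^ (1/s))))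
    (f : Euc d → ℂ) (hf : ContDiff ℝ (⊤ : ℕ∞) f)
    (hper : ∀ (x : Euc d) (j : Fin d → ℤ), f (x + latPt e j) = f x) :
    (∀ r : ℝ, 0 < r → ∃ C : ℝ, 0 < C ∧ ∀ x ξ : Euc d,
        ‖STFT φ f x ξ‖ ≤ C * Real.exp (-r * ‖ξ‖ ^ (1/s)))
    ↔
    (∀ r' : ℝ, 0 < r' → ∃ C' : ℝ, 0 < C' ∧ ∀ ι : Fin d → ℤ,
        ‖fourCoeff e f (latPt e' ι)‖ ≤ C' * Real.exp (-r' * ‖latPt e' ι‖ ^ (1/s))) := by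
  have hp : 0 < 1 / s := by positivity
  set p := 1 / s with hpdef
  constructor
  · intro h r hr
    obtain ⟨η, hη⟩ := exists_FT_ne_zero hφc hφi hφne
    obtain ⟨C, hC, hle⟩ := h (r * 2 ^ p) (by positivity)
    have hη' : 0 < ‖FT φ η‖ := norm_pos_iff.mpr hη
    refine ⟨C * Real.exp (r * 2 ^ p * ‖η‖ ^ p) / ‖FT φ η‖, by positivity, fun ι => ?_⟩
    have h1 := norm_fourCoeff_mul_norm_FT_le he hdual hφi hf.continuous hper
      (fun x => hle x (latPt e' ι - η)) ι
    rw [sub_sub_cancel, ← le_div_iff₀ hη'] at h1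
    refine h1.trans ?_
    rw [div_mul_eq_mul_div, mul_assoc, ← Real.exp_add]
    gcongr
    have h2 := norm_rpow_le_two_rpow_mul (latPt e' ι) (latPt e' ι - η) hp.le
    rw [sub_sub_cancel_left, norm_neg] at h2
    nlinarith
  · intro h r hr
    obtain ⟨C₁, hC₁, hle₁⟩ := h (r * 2 ^ p + 1) (by positivity)
    obtain ⟨C₂, hC₂, -, hle₂⟩ := hφ (r * 2 ^ p) (by positivity)
    have hS := summable_exp_neg_norm_latPt_rpow_s8 hdual hp
    set S := ∑' ι : Fin d → ℤ, Real.exp (-‖latPt e' ι‖ ^ p)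
    have hS0 : 0 ≤ S := tsum_nonneg fun _ => (Real.exp_pos _).le
    refine ⟨C₁ * C₂ * (S + 1), by positivity, fun x ξ => ?_⟩
    have hsum : Summable fun ι : Fin d → ℤ => ‖fourCoeff e f (latPt e' ι)‖ := by
      refine (hS.mul_left C₁).of_nonneg_of_le (fun _ => norm_nonneg _) fun ι => (hle₁ ι).trans ?_
      gcongr
      have : 0 ≤ r * 2 ^ p * ‖latPt e' ι‖ ^ p := by positivity
      linarith
    refine (norm_STFT_le_tsum he hdual hφi hf.continuous hper hsum
      (hS.mul_left (C₁ * C₂ * Real.exp (-r * ‖ξ‖ ^ p))) x ξ fun ι => ?_).trans ?_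
    · refine (mul_le_mul (hle₁ ι) (hle₂ _) (norm_nonneg _) (by positivity)).trans ?_
      rw [mul_mul_mul_comm, mul_assoc (C₁ * C₂) (Real.exp (-r * _)), ← Real.exp_add,
        ← Real.exp_add]
      refine mul_le_mul_of_nonneg_left (Real.exp_le_exp.mpr ?_) (by positivity)
      have h2 := norm_rpow_le_two_rpow_mul ξ (latPt e' ι) hp.le
      nlinarith
    · rw [tsum_mul_left, mul_right_comm]
      gcongr
      linarith

end
end
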